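/- arXiv:2111.05758 — 2 statements merged into one kernel-verified Lean document; each statement's English description precedes it below -/
import Mathlib

section
/- For every n ≥ 1, the bivariate Eulerian polynomial is homogeneous γ-positive: A_n(x,y) = Σ_{k=1}^{⌊(n+1)/2⌋} γ_{n,k} (xy)^k (x+y)^{n+1−2k}, where γ_{n,k} = #{π ∈ S_n : des(π) = k, dd(π) = 0} and dd(π) is the number of double descents. -/
open scoped Classical
open Finset MvPolynomial

/-- The word `w` padded with a `0` at the front and at the end; `pad w i` is the
`i`-th letter of `0, w_1, …, w_M, 0` (so `pad w 0 = 0 = pad w (M+1)`). -/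
def pad (w : List ℕ) : ℕ → ℕ := fun i => (0 :: (w ++ [0])).getD i 0

/-- number of descents (indices `0 ≤ i ≤ M` with `π_i > π_{i+1}`, convention `π_0 = π_{M+1} = 0`). -/
def desN (w : List ℕ) : ℕ :=
  ((Finset.range (w.length + 1)).filter fun i => pad w (i + 1) < pad w i).card

/-- number of ascents. -/
def ascN (w : List ℕ) : ℕ :=
  ((Finset.range (w.length + 1)).filter fun i => pad w i < pad w (i + 1)).card

/-- number of plateaus. -/
def platN (w : List ℕ) : ℕ :=
  ((Finset.range (w.length + 1)).filter fun i => pad w i = pad w (i + 1)).card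

/-- number of double descents: indices `1 ≤ i ≤ M` with `π_{i-1} > π_i > π_{i+1}`. -/
def ddN (w : List ℕ) : ℕ :=
  ((Finset.range w.length).filter fun i =>
    pad w (i + 1) < pad w i ∧ pad w (i + 2) < pad w (i + 1)).card

/-- number of cyclic descents: indices `1 ≤ i ≤ M` with `π_i > π_{i+1}`, cyclic convention
`π_{M+1} = π_1`. -/
def cdesN (w : List ℕ) : ℕ :=
  ((Finset.range w.length).filter fun i =>
    w.getD ((i + 1) % w.length) 0 < w.getD i 0).card

/-- number of cyclic ascents. -/
def cascN (w : List ℕ) : ℕ :=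
  ((Finset.range w.length).filter fun i =>
    w.getD i 0 < w.getD ((i + 1) % w.length) 0).card

/-- The permutations of `[n] = {1,…,n}`, as words (lists). -/
def Sn (n : ℕ) : Finset (List ℕ) := (List.range' 1 n).permutations.toFinset

/-- quasi-Stirling: no four positions `i<j<k<l` with `w_i = w_k`, `w_j = w_l`, `w_i ≠ w_j`
(no subword order-isomorphic to 1212 or 2121). -/
def IsQS (w : List ℕ) : Prop :=
  ¬ ∃ i j k l, i < j ∧ j < k ∧ k < l ∧ l < w.length ∧
      w.getD i 0 = w.getD k 0 ∧ w.getD j 0 = w.getD l 0 ∧ w.getD i 0 ≠ w.getD j 0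

/-- The multiset `{1^{m 1}, …, n^{m n}}`, written as a (weakly increasing) list. -/
def msetList (n : ℕ) (m : ℕ → ℕ) : List ℕ :=
  (List.range n).flatMap fun i => List.replicate (m (i + 1)) (i + 1)

/-- The finite set of quasi-Stirling multipermutations of `{1^{m 1}, …, n^{m n}}`. -/
noncomputable def QS (n : ℕ) (m : ℕ → ℕ) : Finset (List ℕ) :=
  (msetList n m).permutations.toFinset.filter IsQS

/-- `p` is a position of `w` holding a non-leftmost copy of its value. -/
def nonFirstPos (w : List ℕ) (p : ℕ) : Prop :=
  p < w.length ∧ ∃ q, q < p ∧ w.getD q 0 = w.getD p 0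

/-- Rooted quasi-Stirling multipermutations: pairs `(π, r)` where `π` is quasi-Stirling and
either `r = none` (rooted at `0`) or `r = some p` with `p` a position of a non-first copy. -/
noncomputable def RootedQS (n : ℕ) (m : ℕ → ℕ) : Finset (List ℕ × Option ℕ) :=
  ((QS n m) ×ˢ insert none ((Finset.range (msetList n m).length).image some)).filter
    fun P => ∀ r, P.2 = some r → nonFirstPos P.1 r

/-- Sum of the block sizes of the blocks preceding block `i`. -/
def offsetC {k : ℕ} (c : Fin k → ℕ) (i : Fin k) : ℕ :=
  ∑ j ∈ Finset.univ.filter (fun j : Fin k => (j : ℕ) < (i : ℕ)), c j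

/-- The `i`-th block of the ordered set partition encoded by the word `w` together with the
composition `c` of block sizes. -/
def blockOf (k : ℕ) (w : List ℕ) (c : Fin k → ℕ) (i : Fin k) : List ℕ :=
  (w.drop (offsetC c i)).take (c i)

/-- `B_{n,k}`: ordered set partitions of `[n]` into `k` possibly empty blocks, each block
written as a permutation of its elements; encoded as a pair `(w, c)` of a permutation word
`w` of `[n]` and a composition `c` of `n` into `k` nonnegative parts (the block sizes). -/
def Bnk (n k : ℕ) : Finset (List ℕ × (Fin k → ℕ)) :=
  Sn n ×ˢ Finset.Nat.antidiagonalTuple k n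

/-- blockwise descent number of an ordered set partition. -/
def desB {k : ℕ} (P : List ℕ × (Fin k → ℕ)) : ℕ := ∑ i, desN (blockOf k P.1 P.2 i)

/-- blockwise ascent number of an ordered set partition. -/
def ascB {k : ℕ} (P : List ℕ × (Fin k → ℕ)) : ℕ := ∑ i, ascN (blockOf k P.1 P.2 i)

/-- number of empty blocks of an ordered set partition. -/
def empB {k : ℕ} (P : List ℕ × (Fin k → ℕ)) : ℕ :=
  (Finset.univ.filter fun i => P.2 i = 0).card

/-- `A(x,y,u) = Σ_{n ≥ 0} A_n(x,y) uⁿ/n!`, power series in `u` with coefficients in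
`ℚ[x,y,z] = MvPolynomial (Fin 3) ℚ` (`x = X 0`, `y = X 1`, `z = X 2`). -/
noncomputable def AEGF3 : PowerSeries (MvPolynomial (Fin 3) ℚ) :=
  PowerSeries.mk fun j => (j.factorial : ℚ)⁻¹ •
    ∑ w ∈ Sn j, (X 0 : MvPolynomial (Fin 3) ℚ) ^ desN w * (X 1) ^ ascN w

/-- The global index of the `j`-th gap of block `i` (each block `i` has `c i + 1` gaps). -/
def gapIdx {k : ℕ} (c : Fin k → ℕ) (i : Fin k) (j : ℕ) : ℕ :=
  (∑ j' ∈ Finset.univ.filter (fun j' : Fin k => (j' : ℕ) < (i : ℕ)), (c j' + 1)) + j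

/-- A bar placement `b` (bars per gap, `n + k` gaps in total) is good for the ordered set
partition `(w, c) ∈ B_{n,k}` if every descent gap of every block receives at least one bar. -/
def GoodBars (n k : ℕ) (w : List ℕ) (c : Fin k → ℕ) (b : Fin (n + k) → ℕ) : Prop :=
  ∀ i : Fin k, ∀ j ≤ c i,
    pad (blockOf k w c i) (j + 1) < pad (blockOf k w c i) j →
      ∀ g : Fin (n + k), (g : ℕ) = gapIdx c i j → 1 ≤ b g

/-- `π_i` (1-indexed, `pad w i`) is the last copy of its value in `w`. -/
def lastCopy (w : List ℕ) (i : ℕ) : Prop :=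
  ∀ j, i < j → j ≤ w.length → pad w j ≠ pad w i

/-- `π_p` is the first copy of its value; by convention the boundary entry `π_{M+1} = 0`
is regarded as a second (non-first) copy of `0`. -/
def firstCopy (w : List ℕ) (p : ℕ) : Prop :=
  p ≤ w.length ∧ ∀ j, 1 ≤ j → j < p → pad w j ≠ pad w p

/-- sibling descent of type I at `i`: `π_{i+1}` is a first copy and `π_i > π_{i+1}`. -/
def TypeI (w : List ℕ) (i : ℕ) : Prop :=
  firstCopy w (i + 1) ∧ pad w (i + 1) < pad w i

/-- `i` is a sibling descent: `π_i` is a last copy, and either type I holds at `i` or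
`π_{i+1}` is a non-first copy (type II). -/
def SDes (w : List ℕ) (i : ℕ) : Prop :=
  lastCopy w i ∧ (TypeI w i ∨ ¬ firstCopy w (i + 1))

/-- number of sibling descents (indices `1 ≤ i ≤ M`). -/
noncomputable def sdN (w : List ℕ) : ℕ :=
  ((Finset.Icc 1 w.length).filter (SDes w)).card

/-- number of double sibling descents: indices `2 ≤ i ≤ M` such that both `i-1` and `i`
are sibling descents and `i-1` is of type I. -/
noncomputable def dsdN (w : List ℕ) : ℕ :=
  ((Finset.Icc 2 w.length).filter fun i =>
    SDes w (i - 1) ∧ SDes w i ∧ TypeI w (i - 1)).card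

/-- weight of a letter `b` between `a` and `c`. -/
noncomputable def tw (a b c : ℕ) : MvPolynomial (Fin 3) ℚ :=
  if a < b then (if b < c then X 1 else X 0) else (if b < c then 1 else X 2)

noncomputable def Ww : ℕ → ℕ → List ℕ → MvPolynomial (Fin 3) ℚ
  | _, _, [] => 1
  | a, b, c :: l => tw a b c * Ww b c l

noncomputable def Dd : Derivation ℚ (MvPolynomial (Fin 3) ℚ) (MvPolynomial (Fin 3) ℚ) :=
  mkDerivation ℚ ![X 0 * (X 1 + X 2), X 0, X 0]

lemma Dd0 : Dd (X 0) = X 0 * (X 1 + X 2) := by simp [Dd, mkDerivation_X]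
lemma Dd1 : Dd (X 1) = X 0 := by simp [Dd, mkDerivation_X]
lemma Dd2 : Dd (X 2) = X 0 := by simp [Dd, mkDerivation_X]

lemma Ww_congr (a a' b : ℕ) (l : List ℕ) (h : ¬ a < b) (h' : ¬ a' < b) :
    Ww a b l = Ww a' b l := by
  cases l <;> simp [Ww, tw, h, h']

lemma ins_sum (m : ℕ) : ∀ (l : List ℕ) (a b : ℕ), a ≠ b → (b :: l).Nodup →
    (∀ x ∈ b :: l, 0 < x ∧ x < m) → a < m →
    ((List.permutations'Aux m l).map (fun w => Ww a b (w ++ [0]))).sum +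
      (if a < b then X 0 * Ww m b (l ++ [0]) else 0) = Dd (Ww a b (l ++ [0])) := by
  intro l
  induction l with
  | nil =>
    intro a b hab _ hx ha
    obtain ⟨hb0, hbm⟩ := hx b (by simp)
    have h1 : ¬ m < b := by omega
    have h2 : 0 < m := by omega
    rcases lt_or_gt_of_ne hab with h | h
    · simp [Ww, tw, h, hbm, h1, Dd0]; ring
    · have h' : ¬ a < b := by omega
      simp [Ww, tw, h', hbm, Dd2]
  | cons c l ih =>
    intro a b hab hnd hx ha
    obtain ⟨hb0, hbm⟩ := hx b (by simp)
    obtain ⟨hc0, hcm⟩ := hx c (by simp)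
    have hbc : b ≠ c := by
      intro h; subst h; simp at hnd
    have IH := ih b c hbc (List.nodup_cons.1 hnd).2
      (fun x hx' => hx x (List.mem_cons_of_mem _ hx')) hbm
    have h1 : ¬ m < b := by omega
    have h3 : ¬ m < c := by omega
    have hT : ((List.permutations'Aux m (c :: l)).map (fun w => Ww a b (w ++ [0]))).sum =
        tw a b m * (X 0 * Ww m c (l ++ [0])) + tw a b c *
          ((List.permutations'Aux m l).map (fun w => Ww b c (w ++ [0]))).sum := by
      simp only [List.permutations'Aux, List.map_cons, List.sum_cons, List.map_map,
        Function.comp_def, List.cons_append, Ww, List.sum_map_mul_left]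
      simp [tw, hbm, h3]
    rw [hT]
    simp only [List.cons_append, Ww, Derivation.leibniz, smul_eq_mul]
    rw [← IH]
    rcases lt_or_gt_of_ne hab with h | h <;> rcases lt_or_gt_of_ne hbc with h' | h'
    · simp [tw, h, h', hbm, h1, Dd1]; ring
    · have h2' : ¬ b < c := by omega
      rw [Ww_congr m b c _ h3 h2']
      simp [tw, h, h2', hbm, h1, Dd0]; ring
    · have h2 : ¬ a < b := by omega
      simp [tw, h2, h', hbm]; ring
    · have h2 : ¬ a < b := by omega
      have h2' : ¬ b < c := by omega
      rw [Ww_congr m b c _ h3 h2']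
      simp [tw, h2, h2', hbm, Dd2]; ring

/-- total weight of a word -/
noncomputable def Wt (w : List ℕ) : MvPolynomial (Fin 3) ℚ :=
  match w with
  | [] => 1
  | b :: l => Ww 0 b (l ++ [0])

lemma ins_Wt (m : ℕ) (w : List ℕ) (hw : w ≠ []) (hnd : w.Nodup)
    (hx : ∀ x ∈ w, 0 < x ∧ x < m) :
    ((List.permutations'Aux m w).map Wt).sum = Dd (Wt w) := by
  cases w with
  | nil => exact absurd rfl hw
  | cons b l =>
    obtain ⟨hb0, hbm⟩ := hx b (by simp)
    have h := ins_sum m l 0 b (by omega) hnd hx (by omega)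
    have h1 : ¬ m < b := by omega
    have h2 : 0 < m := by omega
    simp only [List.permutations'Aux, List.map_cons, List.sum_cons, List.map_map,
        Function.comp_def, Wt, List.cons_append, Ww]
    rw [← h]
    simp [tw, hb0, h1, h2, add_comm]

def lst : ℕ → List ℕ
  | 0 => []
  | n + 1 => (n + 1) :: lst n

lemma lst_perm (n : ℕ) : (lst n).Perm (List.range' 1 n) := by
  induction n with
  | zero => simp [lst]
  | succ n ih =>
    rw [List.range'_concat, lst]
    refine (List.Perm.cons _ ih).trans ?_
    simp only [one_mul, add_comm 1 n]
    exact (List.perm_append_singleton _ _).symm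

lemma mem_Sn {n : ℕ} {w : List ℕ} : w ∈ Sn n ↔ w.Perm (List.range' 1 n) := by
  simp [Sn, List.mem_permutations]

lemma Sn_facts {n : ℕ} {w : List ℕ} (h : w ∈ Sn n) :
    w.length = n ∧ w.Nodup ∧ ∀ x ∈ w, 0 < x ∧ x < n + 1 := by
  rw [mem_Sn] at h
  refine ⟨by simpa using h.length_eq, h.nodup_iff.2 List.nodup_range', fun x hx => ?_⟩
  have := h.mem_iff.1 hx
  simp [List.mem_range'] at this
  omega

lemma sum_Sn {M : Type*} [AddCommMonoid M] (n : ℕ) (f : List ℕ → M) :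
    ∑ w ∈ Sn n, f w = ((lst n).permutations'.map f).sum := by
  have hnd : (lst n).permutations'.Nodup :=
    (List.permutations_perm_permutations' _).nodup_iff.1 (List.nodup_permutations _ ((lst_perm n).nodup_iff.2 List.nodup_range'))
  have : Sn n = (lst n).permutations'.toFinset := by
    ext w
    rw [mem_Sn, List.mem_toFinset, List.mem_permutations']
    exact ⟨fun h => h.trans (lst_perm n).symm, fun h => h.trans (lst_perm n)⟩
  rw [this, List.sum_toFinset _ hnd]

noncomputable def SS : Subalgebra ℚ (MvPolynomial (Fin 3) ℚ) :=
  Algebra.adjoin ℚ {X 0, X 1 + X 2}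

lemma SS0 : X 0 ∈ SS := Algebra.subset_adjoin (by simp)
lemma SS1 : X 1 + X 2 ∈ SS := Algebra.subset_adjoin (by simp)

lemma Dd_SS {p : MvPolynomial (Fin 3) ℚ} (hp : p ∈ SS) : Dd p ∈ SS := by
  unfold SS at hp
  induction hp using Algebra.adjoin_induction with
  | mem x hx =>
    rcases hx with rfl | rfl
    · rw [Dd0]; exact SS.mul_mem SS0 SS1
    · rw [map_add, Dd1, Dd2]; exact SS.add_mem SS0 SS0
  | algebraMap r => simp
  | add x y _ _ hx hy => rw [map_add]; exact SS.add_mem hx hy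
  | mul x y hx' hy' hx hy =>
    rw [Derivation.leibniz]
    exact SS.add_mem (SS.mul_mem hx' hy) (SS.mul_mem hy' hx)

lemma sum_flatMap_aux {A B M : Type*} [AddCommMonoid M] (l : List A) (f : A → List B) (g : B → M) :
    ((l.flatMap f).map g).sum = (l.map (fun a => ((f a).map g).sum)).sum := by
  induction l with
  | nil => simp
  | cons a l ih => simp [List.flatMap_cons, ih]

lemma F_mem (n : ℕ) (hn : 1 ≤ n) : ∑ w ∈ Sn n, Wt w ∈ SS := by
  induction n, hn using Nat.le_induction with
  | base =>
    rw [sum_Sn]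
    simp [lst, Wt, Ww, tw, List.permutations', List.permutations'Aux, SS0]
  | succ n hn ih =>
    have : ∑ w ∈ Sn (n + 1), Wt w = Dd (∑ w ∈ Sn n, Wt w) := by
      rw [map_sum, sum_Sn, lst, List.permutations', sum_flatMap_aux,
        ← sum_Sn n (fun w => ((List.permutations'Aux (n + 1) w).map Wt).sum)]
      refine Finset.sum_congr rfl fun w hw => ?_
      obtain ⟨h1, h2, h3⟩ := Sn_facts hw
      refine ins_Wt _ _ ?_ h2 h3
      rintro rfl
      simp at h1; omega
    rw [this]
    exact Dd_SS ih

lemma Ww_prod : ∀ (l : List ℕ) (a b : ℕ), Ww a b l = ∏ i ∈ Finset.range l.length,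
    tw ((a :: b :: l).getD i 0) ((a :: b :: l).getD (i + 1) 0) ((a :: b :: l).getD (i + 2) 0) := by
  intro l
  induction l with
  | nil => intro a b; simp [Ww]
  | cons c l ih =>
    intro a b
    rw [List.length_cons, Finset.prod_range_succ', Ww, ih, mul_comm]
    simp only [List.getD_cons_succ, List.getD_cons_zero, zero_add]

lemma Wt_prod (w : List ℕ) : Wt w = ∏ i ∈ Finset.range w.length,
    tw (pad w i) (pad w (i + 1)) (pad w (i + 2)) := by
  cases w with
  | nil => simp [Wt]
  | cons b l => simp only [Wt, Ww_prod]; simp [pad]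

lemma tw_pow (a b c : ℕ) : tw a b c = X 0 ^ (if a < b ∧ ¬ b < c then 1 else 0) *
    X 1 ^ (if a < b ∧ b < c then 1 else 0) * X 2 ^ (if ¬ a < b ∧ ¬ b < c then 1 else 0) := by
  unfold tw
  by_cases h : a < b <;> by_cases h' : b < c <;> simp [h, h']

noncomputable def pkN (w : List ℕ) : ℕ :=
  ∑ i ∈ Finset.range w.length,
    if pad w i < pad w (i + 1) ∧ ¬ pad w (i + 1) < pad w (i + 2) then 1 else 0
noncomputable def daN (w : List ℕ) : ℕ :=
  ∑ i ∈ Finset.range w.length,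
    if pad w i < pad w (i + 1) ∧ pad w (i + 1) < pad w (i + 2) then 1 else 0
noncomputable def dd2N (w : List ℕ) : ℕ :=
  ∑ i ∈ Finset.range w.length,
    if ¬ pad w i < pad w (i + 1) ∧ ¬ pad w (i + 1) < pad w (i + 2) then 1 else 0

lemma Wt_pow (w : List ℕ) : Wt w = X 0 ^ pkN w * X 1 ^ daN w * X 2 ^ dd2N w := by
  rw [Wt_prod]
  simp only [tw_pow, Finset.prod_mul_distrib, Finset.prod_pow_eq_pow_sum]
  rfl

lemma pad_zero (w : List ℕ) : pad w 0 = 0 := rfl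
lemma pad_last (w : List ℕ) : pad w (w.length + 1) = 0 := by
  simp [pad]
lemma pad_mid (w : List ℕ) (i : ℕ) (h : i < w.length) : pad w (i + 1) = w[i] := by
  simp [pad, List.getD, List.getElem?_append_left h, h]

lemma stats {n : ℕ} (hn : 1 ≤ n) {w : List ℕ} (h : w ∈ Sn n) :
    ddN w = dd2N w ∧ desN w = pkN w + dd2N w ∧ ascN w = pkN w + daN w ∧
      ascN w + desN w = n + 1 ∧ 1 ≤ desN w := by
  obtain ⟨h1, h2, h3⟩ := Sn_facts h
  have hpos : ∀ i < w.length, 0 < pad w (i + 1) := by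
    intro i hi
    rw [pad_mid w i hi]
    exact (h3 _ (List.getElem_mem hi)).1
  have hne : ∀ i ≤ w.length, pad w i ≠ pad w (i + 1) := by
    intro i hi
    rcases i with _ | i
    · have := hpos 0 (by omega)
      rw [pad_zero]; omega
    · rcases Nat.lt_or_ge (i + 1) w.length with h' | h'
      · rw [pad_mid w i (by omega), pad_mid w (i + 1) h']
        intro he
        have := (h2.getElem_inj_iff).1 he
        omega
      · have : i + 1 = w.length := by omega
        have h4 := hpos i (by omega)
        rw [show i + 1 + 1 = w.length + 1 by omega, pad_last]
        omega
  have e1 : ddN w = dd2N w := by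
    rw [ddN, dd2N, Finset.card_filter]
    refine Finset.sum_congr rfl fun i hi => ?_
    rw [Finset.mem_range] at hi
    have := hne i (by omega)
    have := hne (i + 1) (by omega)
    simp only [add_assoc, Nat.reduceAdd] at *
    split_ifs <;> omega
  have e2 : desN w = pkN w + dd2N w := by
    rw [desN, pkN, dd2N, Finset.card_filter, Finset.sum_range_succ', ← Finset.sum_add_distrib]
    simp only [pad_zero, not_lt_zero, if_false, add_zero]
    refine Finset.sum_congr rfl fun i hi => ?_
    rw [Finset.mem_range] at hi
    have := hne i (by omega)
    have := hne (i + 1) (by omega)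
    simp only [add_assoc, Nat.reduceAdd] at *
    split_ifs <;> omega
  have e3 : ascN w = pkN w + daN w := by
    rw [ascN, pkN, daN, Finset.card_filter, Finset.sum_range_succ, ← Finset.sum_add_distrib]
    simp only [pad_last, not_lt_zero, if_false, add_zero]
    refine Finset.sum_congr rfl fun i hi => ?_
    split_ifs <;> omega
  refine ⟨e1, e2, e3, ?_, ?_⟩
  · rw [ascN, desN, Finset.card_filter, Finset.card_filter, ← Finset.sum_add_distrib,
      Finset.sum_congr rfl (g := fun _ => 1)]
    · simp [h1]
    · intro i hi
      rw [Finset.mem_range] at hi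
      have := hne i (by omega)
      split_ifs <;> omega
  · rw [desN, Nat.one_le_iff_ne_zero, ← Nat.pos_iff_ne_zero, Finset.card_pos]
    refine ⟨w.length, ?_⟩
    rw [Finset.mem_filter, pad_last]
    refine ⟨by simp, ?_⟩
    have := hpos (n - 1) (by omega)
    rwa [show n - 1 + 1 = w.length by omega] at this

/-- homogeneous γ-positivity of the bivariate Eulerian polynomial, with
`γ_{n,k} = #{π ∈ S_n : des π = k, dd π = 0}`. -/
theorem stmt13 (n : ℕ) (hn : 1 ≤ n) :
    (∑ w ∈ Sn n, (X 0 : MvPolynomial (Fin 2) ℚ) ^ desN w * (X 1) ^ ascN w) =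
      ∑ j ∈ Finset.Icc 1 ((n + 1) / 2),
        ((((Sn n).filter fun w => desN w = j ∧ ddN w = 0).card : ℕ) :
            MvPolynomial (Fin 2) ℚ) *
          (X 0 * X 1) ^ j * (X 0 + X 1) ^ (n + 1 - 2 * j) := by
  have key : aeval (![X 0 * X 1, X 1, X 0] : Fin 3 → MvPolynomial (Fin 2) ℚ) (∑ w ∈ Sn n, Wt w) =
      aeval (![X 0 * X 1, X 0 + X 1, 0] : Fin 3 → MvPolynomial (Fin 2) ℚ) (∑ w ∈ Sn n, Wt w) := by
    have hle : SS ≤ AlgHom.equalizer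
        (aeval (![X 0 * X 1, X 1, X 0] : Fin 3 → MvPolynomial (Fin 2) ℚ))
        (aeval (![X 0 * X 1, X 0 + X 1, 0] : Fin 3 → MvPolynomial (Fin 2) ℚ)) := by
      refine Algebra.adjoin_le ?_
      rintro x (rfl | rfl)
      · simp [AlgHom.mem_equalizer]
      · simp [AlgHom.mem_equalizer, add_comm]
    exact hle (F_mem n hn)
  rw [map_sum, map_sum] at key
  have hL : ∑ w ∈ Sn n, (X 0 : MvPolynomial (Fin 2) ℚ) ^ desN w * (X 1) ^ ascN w =
      ∑ w ∈ Sn n, aeval (![X 0 * X 1, X 1, X 0] : Fin 3 → MvPolynomial (Fin 2) ℚ) (Wt w) := by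
    refine Finset.sum_congr rfl fun w hw => ?_
    obtain ⟨-, h2, h3, -, -⟩ := stats hn hw
    rw [h2, h3, Wt_pow]
    simp
    ring
  rw [hL, key]
  have hR : ∀ w ∈ Sn n, aeval (![X 0 * X 1, X 0 + X 1, 0] : Fin 3 → MvPolynomial (Fin 2) ℚ) (Wt w) =
      if ddN w = 0 then (X 0 * X 1) ^ desN w * (X 0 + X 1) ^ (n + 1 - 2 * desN w) else 0 := by
    intro w hw
    obtain ⟨h1, h2, h3, h4, -⟩ := stats hn hw
    rw [Wt_pow]
    split_ifs with h
    · have h5 : dd2N w = 0 := by omega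
      rw [h2, h5, show n + 1 - 2 * (pkN w + 0) = daN w by omega]
      simp
    · have h5 : dd2N w ≠ 0 := by omega
      simp [h5]
  rw [Finset.sum_congr rfl hR, ← Finset.sum_filter,
    ← Finset.sum_fiberwise_of_maps_to (g := desN) (t := Finset.Icc 1 ((n + 1) / 2))]
  · refine Finset.sum_congr rfl fun j _ => ?_
    rw [Finset.filter_filter, Finset.sum_congr rfl
      (g := fun _ => (X 0 * X 1) ^ j * (X 0 + X 1) ^ (n + 1 - 2 * j))]
    · rw [Finset.sum_const, nsmul_eq_mul, mul_assoc]
      simp only [and_comm]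
    · intro w hw
      rw [(Finset.mem_filter.1 hw).2.2]
  · intro w hw
    rw [Finset.mem_filter] at hw
    obtain ⟨h1, h2, h3, h4, h5⟩ := stats hn hw.1
    rw [Finset.mem_Icc]
    omega
end

section
/- For every n ≥ 1, Σ_{m≥0} m^n·C(m+n, m)·t^m = (n+1)·Q̄_n(t)/(1−t)^{2n+1} as formal power series in t, where Q̄_n(t) is the descent polynomial of quasi-Stirling permutations of {1², ..., n²}. -/
open scoped Classical
open Finset MvPolynomial

namespace QSProof
open Polynomial in
/-- `(x-1)^r x^(n-r)` as a polynomial. -/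
noncomputable def F (n r : ℕ) : Polynomial ℚ := (Polynomial.X - 1) ^ r * Polynomial.X ^ (n - r)

def mc (N d m : ℕ) : ℚ := if d ≤ m then (Nat.multichoose N (m - d) : ℚ) else 0

noncomputable def g (n r N d m : ℕ) : ℚ :=
  mc N d m * (F n r).eval (m : ℚ) - mc (N + 1) (d + 1) m * (Polynomial.derivative (F n r)).eval (m : ℚ)

noncomputable def gp (n r N d : ℕ) : PowerSeries ℚ := PowerSeries.mk (g n r N d)

theorem mc_pascal (N d m : ℕ) : mc N d m = mc (N + 1) d m - mc (N + 1) (d + 1) m := by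
  unfold mc
  rcases lt_trichotomy m d with h | h | h
  · rw [if_neg (by omega), if_neg (by omega), if_neg (by omega)]; simp
  · subst h; simp
  · obtain ⟨k, rfl⟩ : ∃ k, m = d + k + 1 := ⟨m - d - 1, by omega⟩
    rw [if_pos (by omega), if_pos (by omega), if_pos (by omega)]
    have e1 : d + k + 1 - d = k + 1 := by omega
    have e2 : d + k + 1 - (d + 1) = k := by omega
    rw [e1, e2, Nat.multichoose_succ_succ]
    push_cast; ring

theorem mc_shift (N d m : ℕ) : mc N (d + 1) (m + 1) = mc N d m := by
  unfold mc; simp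

theorem mc_zero (N d : ℕ) : mc N (d + 1) 0 = 0 := by
  unfold mc; simp

theorem F_split (n r : ℕ) (h : r ≤ n) : F n r = F (n + 1) r - F (n + 1) (r + 1) := by
  unfold F
  obtain ⟨k, rfl⟩ := Nat.exists_eq_add_of_le h
  have e1 : r + k - r = k := by omega
  have e2 : r + k + 1 - r = k + 1 := by omega
  have e3 : r + k + 1 - (r + 1) = k := by omega
  rw [e1, e2, e3]; ring

theorem gp_A (n r N d : ℕ) : gp n r N d = gp n r (N + 1) d - gp n r (N + 1) (d + 1) := by
  ext m
  simp only [gp, PowerSeries.coeff_mk, map_sub, g]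
  rw [mc_pascal N d m, mc_pascal (N + 1) (d + 1) m]; ring

theorem gp_B (n r N d : ℕ) (h : r ≤ n) : gp n r N d = gp (n + 1) r N d - gp (n + 1) (r + 1) N d := by
  ext m
  simp only [gp, PowerSeries.coeff_mk, map_sub, g]
  rw [F_split n r h, Polynomial.derivative_sub, Polynomial.eval_sub, Polynomial.eval_sub]; ring

theorem gp_C (n N d : ℕ) : PowerSeries.X * gp n 0 N d = gp n n N (d + 1) := by
  ext m
  rcases m with _ | m
  · simp [gp, g, mc_zero]
  · rw [PowerSeries.coeff_succ_X_mul]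
    simp only [gp, PowerSeries.coeff_mk, g, mc_shift]
    simp [F, Polynomial.derivative_pow]

theorem gp_tel (n N d i j : ℕ) (hij : i ≤ j) (hj : j ≤ n + 1) :
    ∑ r ∈ Finset.Ico i j, gp n r N d = gp (n + 1) i N d - gp (n + 1) j N d := by
  induction j, hij using Nat.le_induction with
  | base => simp
  | succ j hij ih =>
    rw [Finset.sum_Ico_succ_top hij, ih (by omega), gp_B n j N d (by omega)]; ring

theorem gp_empty (n : ℕ) : gp n 0 n 0 = if n = 0 then 1 else 0 := by
  ext m
  rcases n with _ | n
  · simp only [gp, PowerSeries.coeff_mk, g, if_true, PowerSeries.coeff_one]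
    rcases m with _ | m <;> simp [mc, F]
  · simp only [gp, PowerSeries.coeff_mk, g]
    rcases m with _ | m
    · simp [mc, F]
    · simp only [mc, F, Nat.zero_le, if_true]
      rw [if_pos (by omega)]
      have h1 : (Nat.multichoose (n + 1) (m + 1) : ℚ) * (m + 1) =
          (n + 1) * Nat.multichoose (n + 2) m := by
        rw [Nat.multichoose_eq, Nat.multichoose_eq]
        have e1 : n + 1 + (m + 1) - 1 = n + m + 1 := by omega
        have e2 : n + 2 + m - 1 = n + m + 1 := by omega
        rw [e1, e2]
        have := Nat.choose_succ_right_eq (n + m + 1) m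
        have e3 : n + m + 1 - m = n + 1 := by omega
        rw [e3] at this
        have h2 : (((n + m + 1).choose (m + 1) * (m + 1) : ℕ) : ℚ) = (((n + m + 1).choose m * (n + 1) : ℕ) : ℚ) := by
          rw [this]
        push_cast at h2
        linarith
      simp [Polynomial.derivative_pow]
      rw [pow_succ]
      linear_combination ((m : ℚ) + 1) ^ n * h1

/-- number of elements below `c` -/
def rk (S : Finset ℕ) (c : ℕ) : ℕ := (S.filter (fun x => x < c)).card

theorem rk_lt_iff (S : Finset ℕ) (b c : ℕ) (hb : b ∈ S) : rk S b < rk S c ↔ b < c := by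
  constructor
  · intro h
    by_contra h'
    push Not at h'
    have : rk S c ≤ rk S b := by
      apply Finset.card_le_card
      intro x; simp only [Finset.mem_filter]; rintro ⟨h1, h2⟩; exact ⟨h1, by omega⟩
    omega
  · intro h
    apply Finset.card_lt_card
    rw [Finset.ssubset_iff_of_subset]
    · exact ⟨b, by simp [hb, h], by simp⟩
    · intro x; simp only [Finset.mem_filter]; rintro ⟨h1, h2⟩; exact ⟨h1, by omega⟩

theorem rk_mono (S : Finset ℕ) {a c : ℕ} (h : a ≤ c) : rk S a ≤ rk S c := by
  apply Finset.card_le_card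
  intro x; simp only [Finset.mem_filter]; rintro ⟨h1, h2⟩; exact ⟨h1, by omega⟩

theorem rk_le_card (S : Finset ℕ) (c : ℕ) : rk S c ≤ S.card := Finset.card_filter_le _ _

theorem sum_rk {M : Type*} [AddCommMonoid M] (S : Finset ℕ) (f : ℕ → M) :
    ∑ b ∈ S, f (rk S b) = ∑ r ∈ Finset.range S.card, f r := by
  apply Finset.sum_bij (fun b _ => rk S b)
  · intro b hb
    rw [Finset.mem_range]
    have : rk S (b + 1 + S.sup id) ≤ S.card := rk_le_card _ _
    exact lt_of_lt_of_le ((rk_lt_iff S b _ hb).2 (by omega)) this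
  · intro a ha b hb h
    have h1 := rk_lt_iff S a b ha
    have h2 := rk_lt_iff S b a hb
    omega
  · have hinj : Set.InjOn (fun b => rk S b) (S : Set ℕ) := by
      intro a ha b hb h
      have h1 := rk_lt_iff S a b ha
      have h2 := rk_lt_iff S b a hb
      simp only at h
      omega
    have himg : S.image (fun b => rk S b) = Finset.range S.card := by
      apply Finset.eq_of_subset_of_card_le
      · intro r hr
        obtain ⟨b, hb, rfl⟩ := Finset.mem_image.1 hr
        rw [Finset.mem_range]
        exact lt_of_lt_of_le ((rk_lt_iff S b (b+1) hb).2 (by omega)) (rk_le_card _ _)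
      · rw [Finset.card_image_of_injOn hinj, Finset.card_range]
    intro r hr
    rw [← himg] at hr
    obtain ⟨b, hb, h⟩ := Finset.mem_image.1 hr
    exact ⟨b, hb, h⟩
  · intros; rfl

def ind (p : Prop) [Decidable p] : ℕ := if p then 1 else 0

theorem arith_range (n la lc N d ε : ℕ) (hla : la ≤ n) (hlc : lc ≤ n)
    (hε : (ε = 1 ∧ la ≤ lc) ∨ (ε = 0 ∧ lc ≤ la)) :
    (1 - PowerSeries.X) * gp n lc (N + 1) (d + ε) =
      PowerSeries.X ^ ε * gp n la N d +
      ∑ r ∈ Finset.range n, PowerSeries.X ^ ind (r < lc) * gp (n - 1) r (N + 1) (d + ind (la ≤ r)) := by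
  have hC := gp_C n (N + 1) d
  have hA := gp_A n la N d
  rcases n with _ | n
  · obtain rfl : la = 0 := by omega
    obtain rfl : lc = 0 := by omega
    simp only [Finset.range_zero, Finset.sum_empty]
    rw [hA]
    rcases hε with ⟨rfl, _⟩ | ⟨rfl, _⟩
    · simp only [pow_one]; linear_combination -hC
    · simp only [pow_zero, Nat.add_zero]; linear_combination -hC
  have key : ∀ i j, i ≤ j → j ≤ n + 1 → ∀ e δ : ℕ,
      (∀ r, i ≤ r → r < j → ind (r < lc) = e ∧ ind (la ≤ r) = δ) →
      ∑ r ∈ Finset.Ico i j, PowerSeries.X ^ ind (r < lc) * gp (n + 1 - 1) r (N + 1) (d + ind (la ≤ r))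
       = PowerSeries.X ^ e * (gp (n + 1) i (N + 1) (d + δ) - gp (n + 1) j (N + 1) (d + δ)) := by
    intro i j hij hj e δ h
    rw [← gp_tel n (N + 1) (d + δ) i j hij hj, Finset.mul_sum]
    apply Finset.sum_congr rfl
    intro r hr
    rw [Finset.mem_Ico] at hr
    obtain ⟨h1, h2⟩ := h r hr.1 hr.2
    rw [h1, h2]; rfl
  rw [Finset.range_eq_Ico]
  rcases hε with ⟨rfl, h⟩ | ⟨rfl, h⟩
  · rw [← Finset.sum_Ico_consecutive _ (Nat.zero_le la) (by omega : la ≤ n + 1),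
      ← Finset.sum_Ico_consecutive _ h hlc,
      key 0 la (by omega) (by omega) 1 0, key la lc (by omega) (by omega) 1 1,
      key lc (n + 1) (by omega) (by omega) 0 1]
    · simp only [pow_one, pow_zero, one_mul]
      simp only [Nat.add_zero]
      rw [hA]; linear_combination -hC
    all_goals intro r h1 h2; unfold ind; constructor <;> split_ifs <;> omega
  · rw [← Finset.sum_Ico_consecutive _ (Nat.zero_le lc) (by omega : lc ≤ n + 1),
      ← Finset.sum_Ico_consecutive _ h hla,
      key 0 lc (by omega) (by omega) 1 0, key lc la (by omega) (by omega) 0 0,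
      key la (n + 1) (by omega) (by omega) 0 1]
    · simp only [pow_one, pow_zero, one_mul]
      simp only [Nat.add_zero]
      rw [hA]; linear_combination -hC
    all_goals intro r h1 h2; unfold ind; constructor <;> split_ifs <;> omega

theorem rk_erase (S : Finset ℕ) (b : ℕ) : rk (S.erase b) b = rk S b := by
  unfold rk
  congr 1
  ext x; simp only [Finset.mem_filter, Finset.mem_erase]
  constructor
  · rintro ⟨⟨_, h⟩, h2⟩; exact ⟨h, h2⟩
  · rintro ⟨h, h2⟩; exact ⟨⟨by omega, h⟩, h2⟩

theorem gp_congr {n r N d n' r' N' d' : ℕ} (h1 : n = n') (h2 : r = r') (h3 : N = N') (h4 : d = d') :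
    gp n r N d = gp n' r' N' d' := by subst h1 h2 h3 h4; rfl

theorem arith (S : Finset ℕ) (a c N d : ℕ) (ha : a ∉ S) :
    (1 - PowerSeries.X) * gp S.card (rk S c) (N + 1) (d + ind (a < c)) =
      PowerSeries.X ^ ind (a < c) * gp S.card (rk S a) N d +
      ∑ b ∈ S, PowerSeries.X ^ ind (b < c) *
        gp (S.erase b).card (rk (S.erase b) b) (N + 1) (d + ind (a < b)) := by
  have hε : (ind (a < c) = 1 ∧ rk S a ≤ rk S c) ∨ (ind (a < c) = 0 ∧ rk S c ≤ rk S a) := by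
    unfold ind
    by_cases h : a < c
    · left; exact ⟨if_pos h, rk_mono S h.le⟩
    · right; exact ⟨if_neg h, rk_mono S (not_lt.1 h)⟩
  rw [arith_range S.card (rk S a) (rk S c) N d _ (rk_le_card _ _) (rk_le_card _ _) hε]
  congr 1
  rw [← sum_rk S (fun r => PowerSeries.X ^ ind (r < rk S c) *
    gp (S.card - 1) r (N + 1) (d + ind (rk S a ≤ r)))]
  apply Finset.sum_congr rfl
  intro b hb
  rw [rk_erase, Finset.card_erase_of_mem hb]
  have h1 := rk_lt_iff S b c hb
  have h2 := rk_lt_iff S b a hb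
  have hab : a ≠ b := fun h => ha (h ▸ hb)
  have e1 : ind (b < c) = ind (rk S b < rk S c) := by
    unfold ind; split_ifs <;> omega
  have e2 : ind (a < b) = ind (rk S a ≤ rk S b) := by
    unfold ind; split_ifs <;> omega
  rw [e1, e2]
end QSProof
namespace QSProof

/-- descents of `c, w, 0` -/
def desc : ℕ → List ℕ → ℕ
  | c, [] => ind (0 < c)
  | c, x :: w => ind (x < c) + desc x w

theorem desN_aux (c : ℕ) (w : List ℕ) :
    ((Finset.range (w.length + 1)).filter fun i =>
      (c :: (w ++ [0])).getD (i + 1) 0 < (c :: (w ++ [0])).getD i 0).card = desc c w := by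
  induction w generalizing c with
  | nil =>
    rw [Finset.card_filter, List.length_nil, Finset.sum_range_one]
    rfl
  | cons x w ih =>
    rw [Finset.card_filter, List.length_cons, Finset.sum_range_succ', desc, ← ih x, Finset.card_filter,
      add_comm]
    congr 1

theorem desN_eq (w : List ℕ) : desN w = desc 0 w := desN_aux 0 w

/-- words completing the open stack `st`, with new letters `S` -/
noncomputable def comp : ℕ → List ℕ → Finset ℕ → Finset (List ℕ)
  | 0, st, S => if st = [] ∧ S = ∅ then {[]} else ∅
  | L + 1, st, S =>
    (match st with
      | [] => ∅
      | a :: st' => (comp L st' S).image (List.cons a)) ∪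
    S.biUnion fun b => (comp L (b :: st) (S.erase b)).image (List.cons b)

theorem sum_image_cons (T : Finset (List ℕ)) (a c : ℕ) :
    ∑ w ∈ T.image (List.cons a), (PowerSeries.X : PowerSeries ℚ) ^ desc c w =
      PowerSeries.X ^ ind (a < c) * ∑ w ∈ T, (PowerSeries.X : PowerSeries ℚ) ^ desc a w := by
  rw [Finset.sum_image (by intro x _ y _ h; simpa using h), Finset.mul_sum]
  apply Finset.sum_congr rfl
  intro w _
  rw [desc, pow_add]

theorem sum_push (L : ℕ) (st : List ℕ) (S : Finset ℕ) (c : ℕ) :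
    ∑ w ∈ S.biUnion (fun b => (comp L (b :: st) (S.erase b)).image (List.cons b)),
      (PowerSeries.X : PowerSeries ℚ) ^ desc c w =
    ∑ b ∈ S, PowerSeries.X ^ ind (b < c) *
      ∑ w ∈ comp L (b :: st) (S.erase b), (PowerSeries.X : PowerSeries ℚ) ^ desc b w := by
  rw [Finset.sum_biUnion]
  · apply Finset.sum_congr rfl
    intro b _
    rw [sum_image_cons]
  · intro b _ b' _ hbb
    rw [Function.onFun, Finset.disjoint_left]
    intro w hw hw'
    obtain ⟨u, _, rfl⟩ := Finset.mem_image.1 hw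
    obtain ⟨v, _, h⟩ := Finset.mem_image.1 hw'
    simp at h
    exact hbb h.1.symm

theorem sum_cons (L a : ℕ) (st : List ℕ) (S : Finset ℕ) (c : ℕ) (ha : a ∉ S) :
    ∑ w ∈ comp (L + 1) (a :: st) S, (PowerSeries.X : PowerSeries ℚ) ^ desc c w =
    PowerSeries.X ^ ind (a < c) * ∑ w ∈ comp L st S, (PowerSeries.X : PowerSeries ℚ) ^ desc a w +
    ∑ b ∈ S, PowerSeries.X ^ ind (b < c) *
      ∑ w ∈ comp L (b :: a :: st) (S.erase b), (PowerSeries.X : PowerSeries ℚ) ^ desc b w := by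
  rw [comp, Finset.sum_union, sum_push, sum_image_cons]
  rw [Finset.disjoint_left]
  intro w hw hw'
  obtain ⟨u, _, rfl⟩ := Finset.mem_image.1 hw
  obtain ⟨b, hb, h⟩ := Finset.mem_biUnion.1 hw'
  obtain ⟨v, _, h⟩ := Finset.mem_image.1 h
  simp at h
  exact ha (h.1 ▸ hb)

theorem main (L : ℕ) : ∀ (st : List ℕ) (S : Finset ℕ) (c : ℕ), L = st.length + 2 * S.card →
    (∀ x ∈ st, x ∉ S) → 0 ∉ S →
    ∑ w ∈ comp L st S, (PowerSeries.X : PowerSeries ℚ) ^ desc c w =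
      (1 - PowerSeries.X) ^ (L + 1) * gp S.card (rk S c) (S.card + st.length + 1) (desc c st) := by
  induction L with
  | zero =>
    intro st S c hL hst h0
    have h1 : st = [] := List.eq_nil_of_length_eq_zero (by omega)
    have h2 : S = ∅ := Finset.card_eq_zero.1 (by omega)
    subst h1 h2
    have h := arith ∅ 0 c 0 0 (by simp)
    have h3 := gp_empty 0
    simp only [rk, Finset.filter_empty, Finset.card_empty] at h ⊢
    rw [h3] at h
    rw [comp, if_pos ⟨rfl, rfl⟩, Finset.sum_singleton]
    simp only [desc]
    simpa using h.symm
  | succ L ih =>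
    intro st S c hL hst h0
    have hpush : ∀ b ∈ S, ∑ w ∈ comp L (b :: st) (S.erase b), (PowerSeries.X : PowerSeries ℚ) ^ desc b w
        = (1 - PowerSeries.X) ^ (L + 1) *
          gp (S.erase b).card (rk (S.erase b) b) (S.card + st.length + 1) (desc b st) := by
      intro b hb
      have hcard : S.card ≠ 0 := by
        intro h; rw [Finset.card_eq_zero] at h; subst h; simp at hb
      have he := Finset.card_erase_of_mem hb
      rw [ih (b :: st) (S.erase b) b]
      · congr 1
        apply gp_congr rfl rfl
        · rw [he, List.length_cons]; omega
        · simp [desc, ind]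
      · rw [he, List.length_cons]; omega
      · intro x hx
        rcases List.mem_cons.1 hx with rfl | hx
        · simp
        · intro h; exact hst x hx (Finset.mem_of_mem_erase h)
      · intro h; exact h0 (Finset.mem_of_mem_erase h)
    rw [pow_succ, mul_assoc]
    rcases st with _ | ⟨a, st⟩
    · have h := arith S 0 c S.card 0 h0
      have hr : rk S 0 = 0 := by simp [rk]
      have hne : S.card ≠ 0 := by simp at hL; omega
      rw [hr, gp_empty, if_neg hne, mul_zero, zero_add, zero_add] at h
      simp only [desc, List.length_nil, Nat.add_zero]
      rw [h, comp, Finset.empty_union, sum_push, Finset.mul_sum]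
      apply Finset.sum_congr rfl
      intro b hb
      rw [hpush b hb, zero_add]
      simp only [desc, List.length_nil, Nat.add_zero]
      ring
    · have h := arith S a c (S.card + st.length + 1) (desc a st) (hst a (by simp))
      rw [sum_cons _ _ _ _ _ (hst a (by simp)), ih st S a]
      · simp only [desc, List.length_cons]
        rw [add_comm (ind (a < c)), ← add_assoc S.card, h, mul_add, Finset.mul_sum]
        congr 1
        · ring
        · apply Finset.sum_congr rfl
          intro b hb
          rw [hpush b hb]
          simp only [desc, List.length_cons]
          rw [add_comm (ind (a < b)), ← add_assoc S.card]
          ring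
      · simp at hL; omega
      · intro x hx; exact hst x (by simp [hx])
      · exact h0

/-- sublist version of quasi-Stirling -/
def QS' (w : List ℕ) : Prop := ∀ a b, a ≠ b → ¬ [a, b, a, b].Sublist w

theorem isQS_iff (w : List ℕ) : IsQS w ↔ QS' w := by
  unfold IsQS QS'
  constructor
  · intro h a b hab hs
    apply h
    obtain ⟨f, hf⟩ := List.sublist_iff_exists_fin_orderEmbedding_get_eq.1 hs
    have l0 : (0 : ℕ) < [a, b, a, b].length := by simp
    have l1 : (1 : ℕ) < [a, b, a, b].length := by simp
    have l2 : (2 : ℕ) < [a, b, a, b].length := by simp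
    have l3 : (3 : ℕ) < [a, b, a, b].length := by simp
    have g0 := hf ⟨0, l0⟩
    have g1 := hf ⟨1, l1⟩
    have g2 := hf ⟨2, l2⟩
    have g3 := hf ⟨3, l3⟩
    simp only [List.get_eq_getElem, List.getElem_cons_zero, List.getElem_cons_succ] at g0 g1 g2 g3
    refine ⟨f ⟨0, l0⟩, f ⟨1, l1⟩, f ⟨2, l2⟩, f ⟨3, l3⟩, ?_, ?_, ?_, ?_, ?_⟩
    · exact f.strictMono (by simp)
    · exact f.strictMono (by simp)
    · exact f.strictMono (by simp)
    · exact (f ⟨3, l3⟩).2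
    · rw [List.getD_eq_getElem _ _ (f ⟨0, l0⟩).2, List.getD_eq_getElem _ _ (f ⟨1, l1⟩).2,
        List.getD_eq_getElem _ _ (f ⟨2, l2⟩).2, List.getD_eq_getElem _ _ (f ⟨3, l3⟩).2,
        ← g0, ← g1, ← g2, ← g3]
      exact ⟨rfl, rfl, hab⟩
  · rintro h ⟨i, j, k, l, hij, hjk, hkl, hl, e1, e2, e3⟩
    apply h _ _ e3
    have : [w.getD i 0, w.getD j 0, w.getD i 0, w.getD j 0] =
        [(⟨i, by omega⟩ : Fin w.length), ⟨j, by omega⟩, ⟨k, by omega⟩, ⟨l, hl⟩].map (fun p => w[p]) := by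
      rw [List.getD_eq_getElem _ _ (by omega : i < w.length), List.getD_eq_getElem _ _ (by omega : k < w.length)] at e1
      rw [List.getD_eq_getElem _ _ (by omega : j < w.length), List.getD_eq_getElem _ _ (by omega : l < w.length)] at e2
      simp only [List.map_cons, List.map_nil, Fin.getElem_fin]
      rw [List.getD_eq_getElem _ _ (by omega : i < w.length), List.getD_eq_getElem _ _ (by omega : j < w.length)]
      rw [← e1, ← e2]
    rw [this]
    apply List.map_getElem_sublist
    simp [List.pairwise_cons]
    omega

theorem no_aya (u v : List ℕ) (a y : ℕ) (hy : y ≠ a) (hu : a ∉ u) (hv : a ∉ v) :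
    ¬ [a, y, a].Sublist (u ++ a :: a :: v) := by
  intro h
  induction u with
  | nil =>
    simp only [List.nil_append] at h
    rw [List.cons_sublist_cons] at h
    cases h with
    | cons _ h => exact hv (h.subset (by simp))
    | cons_cons _ h => exact hy rfl
  | cons x u ih =>
    simp only [List.mem_cons, not_or] at hu
    cases h with
    | cons _ h => exact ih hu.2 h
    | cons_cons _ h => exact hu.1 rfl

theorem QS'_del (u v : List ℕ) (a : ℕ) (hu : a ∉ u) (hv : a ∉ v) :
    QS' (u ++ a :: a :: v) ↔ QS' (u ++ v) := by
  constructor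
  · intro h x y hxy hs
    refine h x y hxy (hs.trans ?_)
    refine List.Sublist.append_left ?_ u
    exact (List.sublist_cons_self _ _).trans (List.sublist_cons_self _ _)
  · intro h x y hxy hs
    by_cases hx : x = a
    · subst hx
      exact no_aya u v x y hxy.symm hu hv (List.Sublist.trans (by simp) hs)
    by_cases hy : y = a
    · subst hy
      exact no_aya u v y x hxy hu hv (List.Sublist.trans (by simp) hs)
    apply h x y hxy
    have := hs.filter (fun z => decide (z ≠ a))
    have fu : ∀ t : List ℕ, a ∉ t → t.filter (fun z => decide (z ≠ a)) = t := by
      intro t ht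
      rw [List.filter_eq_self]
      intro z hz
      simp only [decide_eq_true_eq]
      rintro rfl; exact ht hz
    rw [List.filter_append, List.filter_cons_of_neg (a := a) (l := a :: v) (by simp),
      List.filter_cons_of_neg (a := a) (l := v) (by simp),
      fu u hu, fu v hv] at this
    simpa [List.filter_cons, hx, hy] using this

theorem comp_length (L : ℕ) : ∀ st S w, w ∈ comp L st S → w.length = L := by
  induction L with
  | zero =>
    intro st S w h
    rw [comp] at h
    split_ifs at h <;> simp_all
  | succ L ih =>
    intro st S w h
    rw [comp.eq_def, Finset.mem_union] at h
    rcases h with h | h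
    · rcases st with _ | ⟨a, st⟩
      · simp at h
      · obtain ⟨u, hu, rfl⟩ := Finset.mem_image.1 h
        simp [ih _ _ _ hu]
    · obtain ⟨b, hb, h⟩ := Finset.mem_biUnion.1 h
      obtain ⟨u, hu, rfl⟩ := Finset.mem_image.1 h
      simp [ih _ _ _ hu]

theorem mem_comp_succ (L : ℕ) (st : List ℕ) (S : Finset ℕ) (x : ℕ) (w : List ℕ) :
    x :: w ∈ comp (L + 1) st S ↔ (∃ st', st = x :: st' ∧ w ∈ comp L st' S) ∨
      (x ∈ S ∧ w ∈ comp L (x :: st) (S.erase x)) := by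
  rw [comp.eq_def, Finset.mem_union]
  apply or_congr
  · rcases st with _ | ⟨a, st⟩
    · simp
    · simp only [Finset.mem_image, List.cons.injEq]
      constructor
      · rintro ⟨u, hu, rfl, rfl⟩; exact ⟨st, ⟨rfl, rfl⟩, hu⟩
      · rintro ⟨st', ⟨rfl, rfl⟩, hu⟩; exact ⟨w, hu, rfl, rfl⟩
  · simp only [Finset.mem_biUnion, Finset.mem_image, List.cons.injEq]
    constructor
    · rintro ⟨b, hb, u, hu, rfl, rfl⟩; exact ⟨hb, hu⟩
    · rintro ⟨hb, hu⟩; exact ⟨x, hb, w, hu, rfl, rfl⟩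

def Cnt (st : List ℕ) (S : Finset ℕ) (w : List ℕ) : Prop :=
  ∀ x, w.count x = ind (x ∈ st) + 2 * ind (x ∈ S)

theorem mem_comp (L : ℕ) : ∀ st S w, st.Nodup → (∀ x ∈ st, x ∉ S) → w.length = L →
    (w ∈ comp L st S ↔ Cnt st S w ∧ QS' (st.reverse ++ w)) := by
  induction L with
  | zero =>
    intro st S w hnd hst hw
    obtain rfl := List.eq_nil_of_length_eq_zero hw
    rw [comp]
    constructor
    · intro h
      split_ifs at h with h'
      · obtain ⟨rfl, rfl⟩ := h'
        refine ⟨fun x => by simp [ind], ?_⟩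
        intro a b _ h; simp at h
      · simp at h
    · rintro ⟨h1, -⟩
      have : st = [] ∧ S = ∅ := by
        constructor
        · apply List.eq_nil_iff_forall_not_mem.2
          intro x hx
          have := h1 x
          simp [ind, hx] at this
          omega
        · apply Finset.eq_empty_of_forall_notMem
          intro x hx
          have := h1 x
          simp [ind, hx] at this
      rw [if_pos this]; simp
  | succ L ih =>
    intro st S w hnd hst hw
    rcases w with _ | ⟨x, w⟩
    · simp at hw
    have hw' : w.length = L := by simpa using hw
    rw [mem_comp_succ]
    have hA : ∀ st', st = x :: st' → (w ∈ comp L st' S ↔ Cnt st S (x :: w) ∧ QS' (st.reverse ++ x :: w)) := by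
      rintro st' rfl
      have hx' : x ∉ st' := (List.nodup_cons.1 hnd).1
      have hxS : x ∉ S := hst x (by simp)
      rw [ih st' S w (List.nodup_cons.1 hnd).2 (fun y hy => hst y (by simp [hy])) hw']
      have hc : Cnt st' S w ↔ Cnt (x :: st') S (x :: w) := by
        apply forall_congr'
        intro y
        rw [List.count_cons]
        by_cases hy : y = x
        · subst hy
          simp [ind, hx', hxS]
        · have : ¬ x = y := fun h => hy h.symm
          simp [ind, hy, this]
      rw [← hc]
      apply and_congr_right
      intro hcw
      have hxw : x ∉ w := by
        rw [← List.count_eq_zero, hcw x]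
        simp [ind, hx', hxS]
      rw [List.reverse_cons, List.append_assoc]
      exact (QS'_del st'.reverse w x (by simpa using hx') hxw).symm
    have hB : x ∈ S → (w ∈ comp L (x :: st) (S.erase x) ↔ Cnt st S (x :: w) ∧ QS' (st.reverse ++ x :: w)) := by
      intro hxS
      have hxst : x ∉ st := fun h => hst x h hxS
      rw [ih (x :: st) (S.erase x) w (List.nodup_cons.2 ⟨hxst, hnd⟩) ?_ hw']
      · rw [List.reverse_cons, List.append_assoc]
        apply and_congr _ Iff.rfl
        apply forall_congr'
        intro y
        rw [List.count_cons]
        by_cases hy : y = x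
        · subst hy
          simp [ind, hxst, hxS]
        · have : ¬ x = y := fun h => hy h.symm
          simp [ind, hy, this]
      · intro y hy
        rcases List.mem_cons.1 hy with rfl | hy
        · simp
        · intro h; exact hst y hy (Finset.mem_of_mem_erase h)
    constructor
    · rintro (⟨st', h1, h2⟩ | ⟨h1, h2⟩)
      · exact (hA st' h1).1 h2
      · exact (hB h1).1 h2
    · intro h
      by_cases hxS : x ∈ S
      · exact Or.inr ⟨hxS, (hB hxS).2 h⟩
      left
      have hxst : x ∈ st := by
        by_contra hxst
        have := h.1 x
        simp [ind, hxst, hxS] at this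
      rcases st with _ | ⟨a, st⟩
      · simp at hxst
      by_cases hxa : x = a
      · subst hxa
        exact ⟨st, rfl, (hA st rfl).2 h⟩
      exfalso
      have hxst' : x ∈ st := by
        rcases List.mem_cons.1 hxst with h | h
        · exact absurd h hxa
        · exact h
      have haw : a ∈ w := by
        have := h.1 a
        rw [List.count_cons_of_ne hxa] at this
        apply List.count_pos_iff.1
        rw [this]; simp [ind]
      apply h.2 x a hxa
      have e : [x, a, x, a] = [x, a] ++ [x, a] := rfl
      rw [e]
      apply List.Sublist.append
      · rw [List.reverse_cons]
        have e : [x, a] = [x] ++ [a] := rfl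
        rw [e]
        apply List.Sublist.append _ (List.Sublist.refl _)
        simpa using hxst'
      · rw [List.cons_sublist_cons]
        simpa using haw

theorem count_msetList (n x : ℕ) :
    (msetList n (fun _ => 2)).count x = 2 * ind (x ∈ Finset.Icc 1 n) := by
  induction n with
  | zero => simp [msetList, ind]
  | succ n ih =>
    unfold msetList at *
    rw [List.range_succ, List.flatMap_append, List.count_append, ih]
    simp only [List.flatMap_cons, List.flatMap_nil, List.append_nil, List.count_replicate, ind,
      Finset.mem_Icc, beq_iff_eq]
    split_ifs <;> omega

theorem length_msetList (n : ℕ) : (msetList n (fun _ => 2)).length = 2 * n := by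
  simp [msetList]; omega

theorem QS_eq (n : ℕ) : QS n (fun _ => 2) = comp (2 * n) [] (Finset.Icc 1 n) := by
  ext w
  unfold QS
  rw [Finset.mem_filter, List.mem_toFinset, List.mem_permutations, isQS_iff]
  constructor
  · rintro ⟨h1, h2⟩
    rw [mem_comp _ _ _ _ List.nodup_nil (by simp) (by rw [h1.length_eq, length_msetList])]
    refine ⟨fun x => ?_, by simpa using h2⟩
    rw [h1.count_eq, count_msetList]; simp [ind]
  · intro h
    rw [mem_comp _ _ _ _ List.nodup_nil (by simp) (comp_length _ _ _ _ h)] at h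
    refine ⟨?_, by simpa using h.2⟩
    rw [List.perm_iff_count]
    intro x
    rw [count_msetList, h.1 x]; simp [ind]

theorem g_final (n m : ℕ) : ((n : ℚ) + 1) * g n 0 (n + 1) 0 m = (m : ℚ) ^ n * ((m + n).choose m : ℕ) := by
  rcases n with _ | n
  · rcases m with _ | m <;> simp [g, mc, F]
  rcases m with _ | m
  · simp [g, mc, F]
  simp only [g, mc, F, Nat.zero_le, if_true]
  rw [if_pos (by omega)]
  have h1 : (Nat.multichoose (n + 2) (m + 1) : ℚ) * (m + 1) =
      (n + 2) * Nat.multichoose (n + 3) m := by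
    rw [Nat.multichoose_eq, Nat.multichoose_eq]
    have e1 : n + 2 + (m + 1) - 1 = n + m + 2 := by omega
    have e2 : n + 3 + m - 1 = n + m + 2 := by omega
    rw [e1, e2]
    have := Nat.choose_succ_right_eq (n + m + 2) m
    have e3 : n + m + 2 - m = n + 2 := by omega
    rw [e3] at this
    have h2 : (((n + m + 2).choose (m + 1) * (m + 1) : ℕ) : ℚ) = (((n + m + 2).choose m * (n + 2) : ℕ) : ℚ) := by
      rw [this]
    push_cast at h2
    linarith
  have h3 : (m + 1 + (n + 1)).choose (m + 1) = Nat.multichoose (n + 2) (m + 1) := by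
    rw [Nat.multichoose_eq]; congr 1; omega
  rw [h3]
  simp [Polynomial.derivative_pow]
  rw [pow_succ]
  linear_combination ((m : ℚ) + 1) ^ n * (n + 1) * h1

end QSProof
/-- `Σ_{m≥0} mⁿ·C(m+n, m)·tᵐ = (n+1)·Q̄_n(t)/(1−t)^{2n+1}`. -/
theorem stmt19 (n : ℕ) (hn : 1 ≤ n) :
    PowerSeries.mk (fun m => (m : ℚ) ^ n * (((m + n).choose m : ℕ) : ℚ)) =
      (((n + 1 : ℕ)) : PowerSeries ℚ) *
        (∑ w ∈ QS n (fun _ => 2), (PowerSeries.X : PowerSeries ℚ) ^ desN w) *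
        ((1 - PowerSeries.X) ^ (2 * n + 1))⁻¹ := by
  have hq : ∑ w ∈ QS n (fun _ => 2), (PowerSeries.X : PowerSeries ℚ) ^ desN w =
      (1 - PowerSeries.X) ^ (2 * n + 1) * QSProof.gp n 0 (n + 1) 0 := by
    have h := QSProof.main (2 * n) [] (Finset.Icc 1 n) 0 (by simp) (by simp) (by simp)
    rw [QSProof.QS_eq]
    simp only [QSProof.desN_eq]
    rw [h]
    simp [QSProof.rk, QSProof.desc, QSProof.ind]
  have hu : (1 - PowerSeries.X : PowerSeries ℚ) ^ (2 * n + 1) * ((1 - PowerSeries.X) ^ (2 * n + 1))⁻¹ = 1 :=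
    PowerSeries.mul_inv_cancel _ (by simp)
  rw [hq]
  have hg : PowerSeries.mk (fun m => (m : ℚ) ^ n * (((m + n).choose m : ℕ) : ℚ)) =
      (((n + 1 : ℕ)) : PowerSeries ℚ) * QSProof.gp n 0 (n + 1) 0 := by
    ext m
    rw [← nsmul_eq_mul, map_nsmul, nsmul_eq_mul]
    simp only [QSProof.gp, PowerSeries.coeff_mk]
    rw [← QSProof.g_final n m]; push_cast; ring
  rw [hg]
  linear_combination (-(((n + 1 : ℕ)) : PowerSeries ℚ) * QSProof.gp n 0 (n + 1) 0) * hu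
end
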